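/- arXiv:1202.5230 — 2 statements merged into one kernel-verified Lean document; each statement's English description precedes it below -/
import Mathlib

section
/- Suppose the total number of wedges W of G is positive. Let w_1, …, w_k be independent wedges, each distributed uniformly over the wedges of G, let X_i be the indicator that w_i is closed, and let X̄ = (1/k) Σ_{i=1}^k X_i. If ε ∈ (0,1), δ ∈ (0,1), and k = ⌈0.5 ε^{-2} ln(2/δ)⌉, then the estimate X̄ · W/3 of the number of triangles satisfies |X̄ · W/3 − T| < ε W/3 with probability greater than 1 − δ. -/
open MeasureTheory
open scoped ENNReal

/-- The set of wedges of a simple graph `G`: pairs `(v, {u, u'})` where `u` and `u'`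
are distinct neighbors of the center vertex `v`. -/
def SimpleGraph.wedgeSet {V : Type*} (G : SimpleGraph V) : Set (V × Sym2 V) :=
  {w | ¬ w.2.IsDiag ∧ ∀ u ∈ w.2, G.Adj w.1 u}

/-- A wedge `(v, {u, u'})` is closed when its endpoints `u` and `u'` are adjacent. -/
def SimpleGraph.WedgeClosed {V : Type*} (G : SimpleGraph V) (w : V × Sym2 V) : Prop :=
  w.2 ∈ G.edgeSet

instance {V : Type*} (G : SimpleGraph V) [DecidableRel G.Adj] :
    DecidablePred G.WedgeClosed :=
  fun w => inferInstanceAs (Decidable (w.2 ∈ G.edgeSet))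

open ProbabilityTheory in
lemma wedge_aux_real {α Ω : Type*} [Fintype α] [MeasurableSpace Ω] (μ : Measure Ω)
    [IsProbabilityMeasure μ] (f : Ω → α) (S : Set α) (hS : 0 < S.ncard)
    (h1 : ∀ x ∈ S, μ (f ⁻¹' {x}) = 1 / (S.ncard : ℝ≥0∞)) (h2 : μ (f ⁻¹' Sᶜ) = 0) (A : Set α) :
    μ.real (f ⁻¹' A) = ((A ∩ S).ncard : ℝ) / S.ncard := by
  classical
  have key : ∀ A : Set α, μ.real (f ⁻¹' A) ≤ ((A ∩ S).ncard : ℝ) / S.ncard := by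
    intro A
    have hsub : f ⁻¹' A ⊆ (⋃ x ∈ (A ∩ S).toFinset, f ⁻¹' {x}) ∪ f ⁻¹' Sᶜ := by
      intro ω hω
      by_cases h : f ω ∈ S
      · left; simp; exact ⟨hω, h⟩
      · right; exact h
    calc μ.real (f ⁻¹' A) ≤ μ.real ((⋃ x ∈ (A ∩ S).toFinset, f ⁻¹' {x}) ∪ f ⁻¹' Sᶜ) :=
          measureReal_mono hsub
      _ ≤ μ.real (⋃ x ∈ (A ∩ S).toFinset, f ⁻¹' {x}) + μ.real (f ⁻¹' Sᶜ) := measureReal_union_le _ _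
      _ = μ.real (⋃ x ∈ (A ∩ S).toFinset, f ⁻¹' {x}) := by rw [measureReal_def (s := f ⁻¹' Sᶜ), h2]; simp
      _ ≤ ∑ x ∈ (A ∩ S).toFinset, μ.real (f ⁻¹' {x}) := measureReal_biUnion_finset_le _ _
      _ = ∑ x ∈ (A ∩ S).toFinset, (1 / (S.ncard : ℝ)) := by
          apply Finset.sum_congr rfl
          intro x hx
          have : x ∈ S := by simp at hx; exact hx.2
          simp [measureReal_def, h1 x this]
      _ = _ := by
          rw [Finset.sum_const, Set.ncard_eq_toFinset_card' (A ∩ S), nsmul_eq_mul, mul_one_div]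
  have hA := key A
  have hB := key Aᶜ
  have hu : 1 ≤ μ.real (f ⁻¹' A) + μ.real (f ⁻¹' Aᶜ) := by
    have := measureReal_union_le (μ := μ) (f ⁻¹' A) (f ⁻¹' Aᶜ)
    rw [← Set.preimage_union, Set.union_compl_self, Set.preimage_univ, probReal_univ] at this
    exact this
  have hc : (A ∩ S).ncard + (Aᶜ ∩ S).ncard = S.ncard := by
    have := Set.ncard_inter_add_ncard_diff_eq_ncard S A
    rw [Set.inter_comm A, Set.inter_comm Aᶜ]; exact this
  have hc' : ((A ∩ S).ncard : ℝ) / S.ncard + ((Aᶜ ∩ S).ncard : ℝ) / S.ncard = 1 := by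
    rw [← add_div, ← Nat.cast_add, hc]
    exact div_self (by positivity)
  linarith

lemma null_aux {Ω : Type*} [MeasurableSpace Ω] (μ : Measure Ω)
    [IsProbabilityMeasure μ] (A : Set Ω) (h : μ.real A + μ.real Aᶜ = 1) :
    NullMeasurableSet A μ := by
  have hA := measurableSet_toMeasurable μ A
  have hB := measurableSet_toMeasurable μ Aᶜ
  have h1 := measureReal_union_add_inter (μ := μ) (s := toMeasurable μ A)
    (t := toMeasurable μ Aᶜ) hB
  have hu : toMeasurable μ A ∪ toMeasurable μ Aᶜ = Set.univ := by
    apply Set.eq_univ_of_univ_subset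
    rw [← Set.union_compl_self A]
    exact Set.union_subset_union (subset_toMeasurable _ _) (subset_toMeasurable _ _)
  rw [hu, probReal_univ] at h1
  simp only [measureReal_def, measure_toMeasurable] at h1 h
  have h0 : μ (toMeasurable μ A ∩ toMeasurable μ Aᶜ) = 0 := by
    have : (μ (toMeasurable μ A ∩ toMeasurable μ Aᶜ)).toReal = 0 := by linarith
    simpa [ENNReal.toReal_eq_zero_iff] using this
  refine ⟨toMeasurable μ A, hA, ?_⟩
  have hd : μ (toMeasurable μ A \ A) = 0 :=
    measure_mono_null (t := toMeasurable μ A ∩ toMeasurable μ Aᶜ)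
      (fun x hx => And.intro hx.1 (subset_toMeasurable μ Aᶜ hx.2)) h0
  have hd' : μ (A \ toMeasurable μ A) = 0 := by
    rw [Set.diff_eq_empty.2 (subset_toMeasurable _ _)]; simp
  exact ae_eq_set.2 ⟨hd', hd⟩

lemma closed_count {V : Type*} [Fintype V] [DecidableEq V]
    (G : SimpleGraph V) [DecidableRel G.Adj] :
    ({x | G.WedgeClosed x} ∩ G.wedgeSet).ncard = 3 * (G.cliqueFinset 3).card := by
  classical
  rw [Set.ncard_eq_toFinset_card']
  set C := ({x | G.WedgeClosed x} ∩ G.wedgeSet).toFinset with hC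
  have hmem : ∀ v a b, (v, s(a, b)) ∈ C ↔ G.Adj a b ∧ G.Adj v a ∧ G.Adj v b := by
    intro v a b
    rw [hC, Set.mem_toFinset]
    simp only [Set.mem_inter_iff, Set.mem_ofPred_eq,
      SimpleGraph.WedgeClosed, SimpleGraph.wedgeSet, SimpleGraph.mem_edgeSet, Sym2.mk_isDiag_iff,
      Sym2.mem_iff]
    constructor
    · rintro ⟨h, _, h2⟩; exact ⟨h, h2 a (Or.inl rfl), h2 b (Or.inr rfl)⟩
    · rintro ⟨h, h1, h2⟩
      refine ⟨h, h.ne, ?_⟩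
      rintro u (rfl | rfl) <;> assumption
  have hmaps : ∀ x ∈ C, insert x.1 x.2.toFinset ∈ G.cliqueFinset 3 := by
    rintro ⟨v, e⟩ hx
    induction e with
    | _ a b =>
      rw [hmem] at hx
      simp only [Sym2.toFinset_mk_eq, SimpleGraph.mem_cliqueFinset_iff]
      exact SimpleGraph.is3Clique_triple_iff.2 ⟨hx.2.1, hx.2.2, hx.1⟩
  rw [Finset.card_eq_sum_card_fiberwise (f := fun x : V × Sym2 V => insert x.1 x.2.toFinset)
    (t := G.cliqueFinset 3) hmaps]
  rw [Finset.sum_const_nat (m := 3), mul_comm]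
  intro t ht
  rw [SimpleGraph.mem_cliqueFinset_iff, SimpleGraph.is3Clique_iff] at ht
  obtain ⟨a, b, c, hab, hac, hbc, rfl⟩ := ht
  have hne1 := hab.ne
  have hne2 := hac.ne
  have hne3 := hbc.ne
  have : {x ∈ C | insert x.1 x.2.toFinset = {a, b, c}} =
      {(a, s(b, c)), (b, s(a, c)), (c, s(a, b))} := by
    ext ⟨v, e⟩
    induction e with
    | _ p q =>
      simp only [Finset.mem_filter, hmem, Sym2.toFinset_mk_eq, Finset.mem_insert,
        Finset.mem_singleton, Prod.mk.injEq, Sym2.eq_iff]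
      constructor
      · rintro ⟨⟨h1, h2, h3⟩, h⟩
        have n1 := h1.ne
        have n2 := h2.ne
        have n3 := h3.ne
        have hv : v ∈ ({a, b, c} : Finset V) := h ▸ by simp
        have hp : p ∈ ({a, b, c} : Finset V) := h ▸ by simp
        have hq : q ∈ ({a, b, c} : Finset V) := h ▸ by simp
        simp only [Finset.mem_insert, Finset.mem_singleton] at hv hp hq
        clear h h1 h2 h3
        grind
      · rintro (⟨rfl, ⟨rfl, rfl⟩ | ⟨rfl, rfl⟩⟩ | ⟨rfl, ⟨rfl, rfl⟩ | ⟨rfl, rfl⟩⟩ |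
          ⟨rfl, ⟨rfl, rfl⟩ | ⟨rfl, rfl⟩⟩) <;>
        refine ⟨by simp [hab, hac, hbc, hab.symm, hac.symm, hbc.symm], ?_⟩ <;>
        (ext z; simp; try tauto)
  rw [this]
  rw [Finset.card_eq_three]
  exact ⟨_, _, _, by simp [hne1], by simp [hne2], by simp [hne3], rfl⟩

open ProbabilityTheory in
lemma indep_aux {α Ω : Type*} [Fintype α] [MeasurableSpace α] [MeasurableSingletonClass α]
    [MeasurableSpace Ω] (μ : Measure Ω)
    [IsProbabilityMeasure μ] {k : ℕ} (w : Fin k → Ω → α) (hm : ∀ i, AEMeasurable (w i) μ)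
    (hindep : ∀ (I : Finset (Fin k)) (s : Fin k → α),
        μ (⋂ i ∈ I, w i ⁻¹' {s i}) = ∏ i ∈ I, μ (w i ⁻¹' {s i})) :
    iIndepFun w μ := by
  rw [iIndepFun_iff_map_fun_eq_pi_map hm]
  have hm' : AEMeasurable (fun ω i => w i ω) μ := aemeasurable_pi_lambda _ hm
  have : ∀ i, IsProbabilityMeasure (μ.map (w i)) := fun i => Measure.isProbabilityMeasure_map (hm i)
  apply Measure.ext_of_singleton
  intro s
  rw [Measure.map_apply_of_aemeasurable hm' (measurableSet_singleton _), Measure.pi_singleton]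
  have := hindep Finset.univ s
  convert this using 1
  · congr 1; ext ω; simp [funext_iff]
  · apply Finset.prod_congr rfl
    intro i _
    rw [Measure.map_apply_of_aemeasurable (hm i) (measurableSet_singleton _)]

/-- Strict two-sided Chernoff bound. -/
lemma strict_tail {Ω : Type*} [MeasurableSpace Ω] (μ : Measure Ω)
    [IsProbabilityMeasure μ] (S : Ω → ℝ) (c : NNReal) (hc : 0 < c)
    (h : ProbabilityTheory.HasSubgaussianMGF S c μ) (t : ℝ) (ht : 0 < t) :
    μ.real {ω | t ≤ |S ω|} < 2 * Real.exp (-t ^ 2 / (2 * c)) := by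
  set l : ℝ := t / c with hl
  have hc' : (0 : ℝ) < c := hc
  have hlpos : 0 < l := by positivity
  have hnull : NullMeasurableSet {ω | t ≤ |S ω|} μ := by
    have := h.aemeasurable
    have hh : AEMeasurable (fun ω => |S ω|) μ := by fun_prop
    exact hh.nullMeasurable (measurableSet_Ici (a := t))
  set g : Ω → ℝ := fun ω => Real.exp (-(l * t)) * (Real.exp (l * S ω) + Real.exp (-l * S ω)) with hg
  have hgi : Integrable g μ :=
    ((h.integrable_exp_mul l).add (h.integrable_exp_mul (-l))).const_mul _
  set f : Ω → ℝ := Set.indicator {ω | t ≤ |S ω|} (fun _ => (1 : ℝ)) with hf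
  have hfi : Integrable f μ := (integrable_const (1 : ℝ)).indicator₀ hnull
  have hfg : ∀ ω, 0 < g ω - f ω := by
    intro ω
    by_cases hω : t ≤ |S ω|
    · have : f ω = 1 := by simp [hf, Set.indicator, hω]
      rw [this, sub_pos]
      simp only [hg]
      rw [mul_add, ← Real.exp_add, ← Real.exp_add]
      rcases le_abs.1 hω with h1 | h1
      · have : (1 : ℝ) ≤ Real.exp (-(l * t) + l * S ω) := Real.one_le_exp (by nlinarith)
        have := Real.exp_pos (-(l * t) + -l * S ω)
        linarith
      · have : (1 : ℝ) ≤ Real.exp (-(l * t) + -l * S ω) := Real.one_le_exp (by nlinarith)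
        have := Real.exp_pos (-(l * t) + l * S ω)
        linarith
    · have : f ω = 0 := by simp [hf, Set.indicator, hω]
      rw [this]
      rw [sub_zero]
      exact mul_pos (Real.exp_pos _) (add_pos (Real.exp_pos _) (Real.exp_pos _))
  have hpos : 0 < ∫ ω, (g ω - f ω) ∂μ := by
    rw [integral_pos_iff_support_of_nonneg (fun ω => (hfg ω).le) (hgi.sub hfi)]
    have : Function.support (fun ω => g ω - f ω) = Set.univ := by
      ext ω; simp only [Function.mem_support, Set.mem_univ, iff_true]; exact (hfg ω).ne'
    rw [this]; simp
  rw [integral_sub hgi hfi] at hpos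
  have hfint : ∫ ω, f ω ∂μ = μ.real {ω | t ≤ |S ω|} := by
    rw [hf, integral_indicator₀ hnull]; simp
  have hgint : ∫ ω, g ω ∂μ ≤ 2 * Real.exp (-t ^ 2 / (2 * c)) := by
    have e1 : ∫ ω, g ω ∂μ = Real.exp (-(l * t)) *
        (ProbabilityTheory.mgf S μ l + ProbabilityTheory.mgf S μ (-l)) := by
      simp only [hg]
      rw [integral_const_mul, integral_add (h.integrable_exp_mul l) (h.integrable_exp_mul (-l))]
      rfl
    have m1 := h.mgf_le l
    have m2 := h.mgf_le (-l)
    rw [neg_sq] at m2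
    have e2 : Real.exp (-(l * t)) * Real.exp (c * l ^ 2 / 2) = Real.exp (-t ^ 2 / (2 * c)) := by
      rw [← Real.exp_add]; congr 1; rw [hl]; field_simp; ring
    rw [e1, ← e2]
    have := Real.exp_pos (-(l * t))
    nlinarith
  linarith

/-- Suppose `W > 0`. Let `w 1, …, w k` be independent wedges, each uniformly distributed
over the wedges of `G`, let `X i` be the indicator that `w i` is closed, and let
`X̄ = (1/k) ∑ i, X i`. If `ε ∈ (0,1)`, `δ ∈ (0,1)`, and `k = ⌈0.5 ε⁻² ln (2/δ)⌉`, then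
the estimate `X̄ · W / 3` of the number of triangles satisfies
`|X̄ · W / 3 − T| < ε W / 3` with probability greater than `1 − δ`. -/
theorem triangle_count_wedge_sampler {V : Type*} [Fintype V] [DecidableEq V]
    (G : SimpleGraph V) [DecidableRel G.Adj]
    (hW : 0 < G.wedgeSet.ncard)
    {Ω : Type*} [MeasurableSpace Ω] (μ : Measure Ω) [IsProbabilityMeasure μ]
    (ε δ : ℝ) (hε : ε ∈ Set.Ioo (0 : ℝ) 1) (hδ : δ ∈ Set.Ioo (0 : ℝ) 1)
    (k : ℕ) (hk : k = ⌈0.5 / ε ^ 2 * Real.log (2 / δ)⌉₊)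
    (w : Fin k → Ω → V × Sym2 V)
    (hindep : ∀ (I : Finset (Fin k)) (s : Fin k → V × Sym2 V),
        μ (⋂ i ∈ I, w i ⁻¹' {s i}) = ∏ i ∈ I, μ (w i ⁻¹' {s i}))
    (hdist : ∀ i, ∀ x ∈ G.wedgeSet, μ (w i ⁻¹' {x}) = 1 / (G.wedgeSet.ncard : ℝ≥0∞))
    (hsupp : ∀ i, μ (w i ⁻¹' G.wedgeSetᶜ) = 0) :
    ENNReal.ofReal (1 - δ) <
      μ {ω | |((k : ℝ)⁻¹ * (∑ i, if G.WedgeClosed (w i ω) then (1 : ℝ) else 0)) *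
                (G.wedgeSet.ncard : ℝ) / 3 - ((G.cliqueFinset 3).card : ℝ)| <
              ε * (G.wedgeSet.ncard : ℝ) / 3} := by
  obtain ⟨hε0, hε1⟩ := hε
  obtain ⟨hδ0, hδ1⟩ := hδ
  have hlog : 0 < Real.log (2 / δ) := Real.log_pos (by rw [lt_div_iff₀ hδ0]; linarith)
  have hk0 : 0 < k := by rw [hk]; exact Nat.ceil_pos.2 (by positivity)
  have hkR : (0 : ℝ) < k := by exact_mod_cast hk0
  have hkge : 0.5 / ε ^ 2 * Real.log (2 / δ) ≤ k := by
    conv_rhs => rw [hk]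
    exact Nat.le_ceil _
  have hkge' : Real.log (2 / δ) ≤ 2 * k * ε ^ 2 := by
    have := mul_le_mul_of_nonneg_right hkge (show 0 ≤ 2 * ε ^ 2 by positivity)
    calc Real.log (2 / δ) = 0.5 / ε ^ 2 * Real.log (2 / δ) * (2 * ε ^ 2) := by
          field_simp; norm_num
      _ ≤ _ := by linarith
  letI : MeasurableSpace (V × Sym2 V) := ⊤
  haveI : DiscreteMeasurableSpace (V × Sym2 V) := ⟨fun _ => trivial⟩
  have hreal := fun i A => wedge_aux_real μ (w i) G.wedgeSet hW (hdist i) (hsupp i) A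
  have hcount := closed_count G
  have hWR : (0 : ℝ) < G.wedgeSet.ncard := by exact_mod_cast hW
  set W : ℝ := (G.wedgeSet.ncard : ℝ) with hWdef
  set T : ℝ := ((G.cliqueFinset 3).card : ℝ) with hT
  have hnull : ∀ i A, NullMeasurableSet (w i ⁻¹' A) μ := by
    intro i A
    apply null_aux
    rw [← Set.preimage_compl, hreal, hreal, ← add_div, ← Nat.cast_add]
    have := Set.ncard_inter_add_ncard_diff_eq_ncard G.wedgeSet A
    rw [Set.inter_comm A, Set.inter_comm Aᶜ, ← Set.diff_eq, this]
    exact div_self hWR.ne'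
  have hm : ∀ i, AEMeasurable (w i) μ := fun i =>
    NullMeasurable.aemeasurable (fun A _ => hnull i A)
  have hind := indep_aux μ w hm hindep
  set X : Fin k → Ω → ℝ := fun i ω => if G.WedgeClosed (w i ω) then (1 : ℝ) else 0 with hX
  have hXm : ∀ i, AEMeasurable (X i) μ := fun i =>
    (Measurable.of_discrete (f := fun x => if G.WedgeClosed x then (1 : ℝ) else 0)).comp_aemeasurable
      (hm i)
  have hXint : ∀ i, ∫ ω, X i ω ∂μ = 3 * T / W := by
    intro i
    have e : X i = (w i ⁻¹' {x | G.WedgeClosed x}).indicator (fun _ => (1 : ℝ)) := by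
      ext ω; simp [hX, Set.indicator]
    rw [e, integral_indicator₀ (hnull i _)]
    simp only [integral_const, smul_eq_mul, mul_one]
    rw [measureReal_restrict_apply_univ, hreal, hcount]
    push_cast; rfl
  have hsub : ∀ i ∈ Finset.univ, ProbabilityTheory.HasSubgaussianMGF
      (fun ω => X i ω - 3 * T / W) ((‖(1 : ℝ) - 0‖₊ / 2) ^ 2) μ := by
    intro i _
    rw [← hXint i]
    apply ProbabilityTheory.hasSubgaussianMGF_of_mem_Icc (hXm i)
    refine ae_of_all _ fun ω => ?_
    simp only [hX]
    split_ifs <;> simp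
  have hindX : ProbabilityTheory.iIndepFun (fun i ω => X i ω - 3 * T / W) μ :=
    hind.comp (fun _ x => (if G.WedgeClosed x then (1 : ℝ) else 0) - 3 * T / W)
      (fun _ => Measurable.of_discrete)
  have hS := ProbabilityTheory.HasSubgaussianMGF.sum_of_iIndepFun hindX hsub
  have htail := strict_tail μ _ _ (by simp; exact hk0) hS (k * ε) (by positivity)
  have hexp : 2 * Real.exp (-(k * ε) ^ 2 /
      (2 * ((∑ i : Fin k, (‖(1 : ℝ) - 0‖₊ / 2) ^ 2 : NNReal) : ℝ))) ≤ δ := by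
    have e : -(k * ε) ^ 2 / (2 * ((∑ i : Fin k, (‖(1 : ℝ) - 0‖₊ / 2) ^ 2 : NNReal) : ℝ))
        = -(2 * k * ε ^ 2) := by
      simp; field_simp
    rw [e]
    calc 2 * Real.exp (-(2 * k * ε ^ 2)) ≤ 2 * Real.exp (-Real.log (2 / δ)) := by
          gcongr
      _ = δ := by rw [Real.exp_neg, Real.exp_log (by positivity)]; field_simp
  have hlt := htail.trans_le hexp
  set B := {ω | k * ε ≤ |∑ i, (X i ω - 3 * T / W)|} with hB
  have hset : {ω | |((k : ℝ)⁻¹ * (∑ i, X i ω)) * W / 3 - T| < ε * W / 3} = Bᶜ := by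
    ext ω
    simp only [hB, Set.mem_setOf_eq, Set.mem_compl_iff, not_le, Finset.sum_sub_distrib,
      Finset.sum_const, Finset.card_univ, Fintype.card_fin, nsmul_eq_mul]
    have e : ((k : ℝ)⁻¹ * (∑ i, X i ω)) * W / 3 - T
        = (W / (3 * k)) * (∑ i, X i ω - k * (3 * T / W)) := by
      field_simp
    rw [e, abs_mul, abs_of_pos (show 0 < W / (3 * k) by positivity)]
    rw [show ε * W / 3 = (W / (3 * k)) * (k * ε) by field_simp]
    exact mul_lt_mul_iff_right₀ (by positivity)
  change _ < μ {ω | |((k : ℝ)⁻¹ * (∑ i, X i ω)) * W / 3 - T| < ε * W / 3}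
  rw [hset]
  have hBn : 1 ≤ μ.real B + μ.real Bᶜ := by
    have := measureReal_union_le (μ := μ) B Bᶜ
    rwa [Set.union_compl_self, probReal_univ] at this
  rw [ENNReal.ofReal_lt_iff_lt_toReal (by linarith) (measure_ne_top _ _)]
  change _ < μ.real Bᶜ
  linarith
end

section
/- Fix d ≥ 2, suppose G has at least one vertex of degree d, and generate a wedge w by choosing a vertex v uniformly at random from the set V_d of degree-d vertices and then choosing a uniformly random unordered pair of distinct neighbors of v. Define the random variable Y as follows: Y = 0 if w is open; Y = 1/3 if w is closed and its triangle has 3 vertices in V_d; Y = 1/2 if w is closed and its triangle has exactly 2 vertices in V_d; Y = 1 if w is closed and its triangle has exactly 1 vertex in V_d. Then E[Y] = T_d / W_d, where W_d = n_d · binom(d,2) and T_d is the number of triangles containing at least one degree-d vertex. -/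
open MeasureTheory
open scoped ENNReal

/-- The unordered pair `{u, u'}` as a finset. -/
def Sym2.pairFinset {V : Type*} [DecidableEq V] (p : Sym2 V) : Finset V :=
  Sym2.lift ⟨fun u u' => ({u, u'} : Finset V), fun u u' => Finset.pair_comm u u'⟩ p

/-- The three vertices of a wedge `(v, {u, u'})`, i.e. `{v, u, u'}`; for a closed wedge
this is its associated triangle. -/
def wedgeTri {V : Type*} [DecidableEq V] (w : V × Sym2 V) : Finset V :=
  insert w.1 w.2.pairFinset

/-- `V_d`: the finset of vertices of `G` of degree `d`. -/
def SimpleGraph.degVerts {V : Type*} [Fintype V] (G : SimpleGraph V)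
    [DecidableRel G.Adj] (d : ℕ) : Finset V :=
  Finset.univ.filter (fun v => G.degree v = d)

/-- The random variable `Y` of the `T_d`-wedge sampler: `Y = 0` if the wedge is open;
`Y = 1/3` if it is closed and its triangle has 3 vertices of degree `d`; `Y = 1/2` if it
is closed and its triangle has exactly 2 vertices of degree `d`; `Y = 1` if it is closed
and its triangle has exactly 1 vertex of degree `d`. -/
noncomputable def Yfun {V : Type*} [Fintype V] [DecidableEq V] (G : SimpleGraph V)
    [DecidableRel G.Adj] (d : ℕ) (w : V × Sym2 V) : ℝ :=
  if ¬ G.WedgeClosed w then 0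
  else if ((wedgeTri w).filter (fun x => G.degree x = d)).card = 3 then 1 / 3
  else if ((wedgeTri w).filter (fun x => G.degree x = d)).card = 2 then 1 / 2
  else if ((wedgeTri w).filter (fun x => G.degree x = d)).card = 1 then 1
  else 0

/-- Wedges form a finite discrete sample space. -/
instance wedgeMeasurableSpace (V : Type*) : MeasurableSpace (V × Sym2 V) := ⊤

theorem mem_pairFinset_aux {V : Type*} [DecidableEq V] (p : Sym2 V) (x : V) :
    x ∈ p.pairFinset ↔ x ∈ p := by
  induction p using Sym2.ind with
  | _ a b => simp [Sym2.pairFinset]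

theorem mem_wedgeTri_aux {V : Type*} [DecidableEq V] (w : V × Sym2 V) (x : V) :
    x ∈ wedgeTri w ↔ x = w.1 ∨ x ∈ w.2 := by
  simp [wedgeTri, mem_pairFinset_aux]

theorem wedgeTri_clique_aux {V : Type*} [Fintype V] [DecidableEq V]
    (G : SimpleGraph V) [DecidableRel G.Adj] (w : V × Sym2 V)
    (hw : w ∈ G.wedgeSet) (hc : G.WedgeClosed w) : wedgeTri w ∈ G.cliqueFinset 3 := by
  obtain ⟨v, p⟩ := w
  induction p using Sym2.ind with
  | _ a b =>
    have hab : G.Adj a b := by simpa [SimpleGraph.WedgeClosed] using hc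
    have hva : G.Adj v a := hw.2 a (by simp)
    have hvb : G.Adj v b := hw.2 b (by simp)
    rw [SimpleGraph.mem_cliqueFinset_iff, SimpleGraph.is3Clique_iff]
    exact ⟨v, a, b, hva, hvb, hab, rfl⟩

theorem fiber_card_aux {V : Type*} [Fintype V] [DecidableEq V]
    (G : SimpleGraph V) [DecidableRel G.Adj] (d : ℕ) (S : Finset (V × Sym2 V))
    (hS : ∀ w, w ∈ S ↔ w ∈ G.wedgeSet ∧ G.degree w.1 = d ∧ G.WedgeClosed w)
    (t : Finset V) (ht : t ∈ G.cliqueFinset 3) :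
    (S.filter (fun w => wedgeTri w = t)).card =
      (t.filter (fun x => G.degree x = d)).card := by
  refine Finset.card_bij (fun w _ => w.1) ?_ ?_ ?_
  · intro w hw
    rw [Finset.mem_filter, hS] at hw
    rw [Finset.mem_filter, ← hw.2, mem_wedgeTri_aux]
    exact ⟨Or.inl rfl, hw.1.2.1⟩
  · intro w hw w' hw' h
    rw [Finset.mem_filter, hS] at hw hw'
    refine Prod.ext h (Sym2.ext fun x => ?_)
    have h1 : w.1 ∉ w.2 := fun hm => G.loopless.irrefl _ (hw.1.1.2 _ hm)
    have h2 : w'.1 ∉ w'.2 := fun hm => G.loopless.irrefl _ (hw'.1.1.2 _ hm)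
    have h3 : x ∈ wedgeTri w ↔ x ∈ wedgeTri w' := by rw [hw.2, hw'.2]
    rw [mem_wedgeTri_aux, mem_wedgeTri_aux] at h3
    replace h : w.1 = w'.1 := h
    by_cases hx : x = w.1
    · subst hx
      rw [h] at h1 ⊢
      exact iff_of_false h1 h2
    · have hx' : x ≠ w'.1 := h ▸ hx
      simpa [hx, hx'] using h3
  · intro v hv
    rw [SimpleGraph.mem_cliqueFinset_iff, SimpleGraph.is3Clique_iff] at ht
    obtain ⟨hvt, hvd⟩ := Finset.mem_filter.1 hv
    have key : ∀ a b, G.Adj v a → G.Adj v b → G.Adj a b → t = {v, a, b} →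
        ∃ w, ∃ _ : w ∈ S.filter (fun w => wedgeTri w = t), w.1 = v := by
      intro a b ha hb hab htt
      refine ⟨(v, s(a, b)), ?_, rfl⟩
      rw [Finset.mem_filter, hS]
      refine ⟨⟨⟨by simpa using hab.ne, ?_⟩, hvd, by simpa [SimpleGraph.WedgeClosed] using hab⟩,
        htt.symm⟩
      intro u hu
      rcases Sym2.mem_iff.1 hu with rfl | rfl <;> assumption
    obtain ⟨a, b, c, hab, hac, hbc, rfl⟩ := ht
    simp only [Finset.mem_insert, Finset.mem_singleton] at hvt
    rcases hvt with rfl | rfl | rfl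
    · exact key _ _ hab hac hbc rfl
    · exact key a c hab.symm hbc hac (by ext; simp; tauto)
    · exact key a b hac.symm hbc.symm hab (by ext; simp; tauto)

theorem Yfun_aux {V : Type*} [Fintype V] [DecidableEq V]
    (G : SimpleGraph V) [DecidableRel G.Adj] (d : ℕ) (w : V × Sym2 V)
    (hw : w ∈ G.wedgeSet) (hd : G.degree w.1 = d) (hc : G.WedgeClosed w) :
    Yfun G d w = 1 / (((wedgeTri w).filter (fun x => G.degree x = d)).card : ℝ) := by
  have h3 : (wedgeTri w).card = 3 :=
    ((SimpleGraph.mem_cliqueFinset_iff).1 (wedgeTri_clique_aux G w hw hc)).card_eq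
  have hle := Finset.card_filter_le (wedgeTri w) (fun x => G.degree x = d)
  have hpos : 0 < ((wedgeTri w).filter (fun x => G.degree x = d)).card :=
    Finset.card_pos.2 ⟨w.1, Finset.mem_filter.2 ⟨(mem_wedgeTri_aux w _).2 (Or.inl rfl), hd⟩⟩
  unfold Yfun
  rw [if_neg (not_not.2 hc)]
  generalize ((wedgeTri w).filter (fun x => G.degree x = d)).card = k at *
  rw [h3] at hle
  interval_cases k <;> norm_num

theorem sum_aux {V : Type*} [Fintype V] [DecidableEq V]
    (G : SimpleGraph V) [DecidableRel G.Adj] (d : ℕ) (S : Finset (V × Sym2 V))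
    (hS : ∀ w, w ∈ S ↔ w ∈ G.wedgeSet ∧ G.degree w.1 = d ∧ G.WedgeClosed w) :
    ∑ w ∈ S, Yfun G d w =
      (((G.cliqueFinset 3).filter (fun t => ∃ v ∈ t, G.degree v = d)).card : ℝ) := by
  have hmap : ∀ w ∈ S, wedgeTri w ∈
      (G.cliqueFinset 3).filter (fun t => ∃ v ∈ t, G.degree v = d) := by
    intro w hw
    obtain ⟨h1, h2, h3⟩ := (hS w).1 hw
    exact Finset.mem_filter.2 ⟨wedgeTri_clique_aux G w h1 h3,
      w.1, (mem_wedgeTri_aux w _).2 (Or.inl rfl), h2⟩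
  rw [← Finset.sum_fiberwise_of_maps_to hmap, Finset.card_eq_sum_ones, Nat.cast_sum]
  refine Finset.sum_congr rfl fun t ht => ?_
  obtain ⟨ht, v, hv, hvd⟩ := Finset.mem_filter.1 ht
  have hpos : 0 < (t.filter (fun x => G.degree x = d)).card :=
    Finset.card_pos.2 ⟨v, Finset.mem_filter.2 ⟨hv, hvd⟩⟩
  have : ∀ w ∈ S.filter (fun w => wedgeTri w = t),
      Yfun G d w = 1 / ((t.filter (fun x => G.degree x = d)).card : ℝ) := by
    intro w hw
    obtain ⟨hwS, rfl⟩ := Finset.mem_filter.1 hw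
    obtain ⟨h1, h2, h3⟩ := (hS w).1 hwS
    exact Yfun_aux G d w h1 h2 h3
  rw [Finset.sum_congr rfl this, Finset.sum_const, fiber_card_aux G d S hS t ht, nsmul_eq_mul]
  have : ((t.filter (fun x => G.degree x = d)).card : ℝ) ≠ 0 := by positivity
  field_simp
  simp

/-- Fix `d ≥ 2`, suppose `G` has a vertex of degree `d`, and generate a wedge by choosing
a vertex `v` uniformly at random from `V_d` and then a uniformly random unordered pair of
distinct neighbors of `v` (so each wedge centered at `v ∈ V_d` has probability
`(1/n_d) · (1/binom(d,2))`). Then `E[Y] = T_d / W_d`, where `W_d = n_d · binom(d,2)` and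
`T_d` is the number of triangles containing at least one degree-`d` vertex. -/
theorem expectation_Y_eq_Td_div_Wd {V : Type*} [Fintype V] [DecidableEq V]
    (G : SimpleGraph V) [DecidableRel G.Adj]
    (d : ℕ) (hd : 2 ≤ d) (hne : (G.degVerts d).Nonempty)
    (μ : Measure (V × Sym2 V)) [IsProbabilityMeasure μ]
    (hsupp : μ {w ∈ G.wedgeSet | G.degree w.1 = d}ᶜ = 0)
    (hμ : ∀ w ∈ G.wedgeSet, G.degree w.1 = d →
        μ {w} = (1 / ((G.degVerts d).card : ℝ≥0∞)) * (1 / (d.choose 2 : ℝ≥0∞))) :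
    ∫ w, Yfun G d w ∂μ =
      (((G.cliqueFinset 3).filter (fun t => ∃ v ∈ t, G.degree v = d)).card : ℝ) /
        (((G.degVerts d).card : ℝ) * (d.choose 2 : ℝ)) := by
  classical
  haveI : MeasurableSingletonClass (V × Sym2 V) := ⟨fun _ => MeasurableSpace.measurableSet_top⟩
  rw [integral_fintype (Integrable.of_finite)]
  let S : Finset (V × Sym2 V) := Finset.univ.filter
    (fun w => w ∈ G.wedgeSet ∧ G.degree w.1 = d ∧ G.WedgeClosed w)
  have hS : ∀ w, w ∈ S ↔ w ∈ G.wedgeSet ∧ G.degree w.1 = d ∧ G.WedgeClosed w := by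
    intro w; simp [S]
  rw [← sum_aux G d S hS, Finset.sum_div,
    ← Finset.sum_subset (Finset.subset_univ S)]
  · refine Finset.sum_congr rfl fun w hw => ?_
    obtain ⟨h1, h2, h3⟩ := (hS w).1 hw
    rw [Measure.real, hμ w h1 h2, smul_eq_mul]
    simp only [one_div, ENNReal.toReal_mul, ENNReal.toReal_inv, ENNReal.toReal_natCast]
    rw [div_eq_mul_inv, mul_inv, mul_comm]
  · intro w _ hw
    by_cases hc : G.WedgeClosed w
    · have : μ {w} = 0 := by
        refine measure_mono_null ?_ hsupp
        rintro x rfl hx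
        exact hw ((hS _).2 ⟨hx.1, hx.2, hc⟩)
      simp [Measure.real, this]
    · simp [Yfun, hc]
end
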